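/- arXiv:2102.07941 — 4 statements merged into one kernel-verified Lean document; each statement's English description precedes it below -/
import Mathlib

section
/- Let F : ℝ → ℝ be a homeomorphism and let A ⊆ ℝ be a set with Hausdorff dimension equal to 1. If for every x ∈ A the derivative F'(x) exists and is non-zero, then the Hausdorff dimension of F(A) is also 1. -/
open MeasureTheory

theorem dimH_image_le_of_hasFDerivWithinAt {E F : Type*} [NormedAddCommGroup E] [NormedSpace ℝ E]
    [FiniteDimensional ℝ E] [NormedAddCommGroup F] [NormedSpace ℝ F] [FiniteDimensional ℝ F]
    {f : E → F} {f' : E → E →L[ℝ] F} {s : Set E}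
    (hf : ∀ x ∈ s, HasFDerivWithinAt f (f' x) s x) : dimH (f '' s) ≤ dimH s := by
  obtain ⟨t, A, -, hst, hA, -⟩ :=
    exists_closed_cover_approximatesLinearOn_of_hasFDerivWithinAt f s f' hf (fun _ ↦ 1)
      (fun _ ↦ one_ne_zero)
  rw [← Set.inter_eq_left.2 hst, Set.inter_iUnion, Set.image_iUnion, dimH_iUnion, dimH_iUnion]
  exact iSup_mono fun n ↦
    (lipschitzOnWith_iff_restrict.2 (hA n).lipschitz).dimH_image_le

theorem homeomorph_image_dimH_one (F : Homeomorph ℝ ℝ) (A : Set ℝ)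
    (hA : dimH A = 1)
    (hdiff : ∀ x ∈ A, ∃ c : ℝ, c ≠ 0 ∧ HasDerivAt F c x) :
    dimH (F '' A) = 1 := by
  refine le_antisymm ((dimH_mono (Set.subset_univ _)).trans_eq Real.dimH_univ) ?_
  have hdiff_symm : ∀ y ∈ F '' A, DifferentiableAt ℝ F.symm y := by
    rintro _ ⟨x, hx, rfl⟩
    obtain ⟨c, hc, hF⟩ := hdiff x hx
    rw [← F.symm_apply_apply x] at hF
    exact (hF.of_local_left_inverse F.symm.continuous.continuousAt hc
      (.of_forall F.apply_symm_apply)).differentiableAt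
  have h := dimH_image_le_of_hasFDerivWithinAt fun y hy ↦
    (hdiff_symm y hy).hasFDerivAt.hasFDerivWithinAt (s := F '' A)
  rwa [Set.image_image, funext F.symm_apply_apply, Set.image_id', hA] at h
end

section
/- Let F : ℝ → ℝ be a function and let A ⊆ ℝ be a set such that for every x ∈ A the derivative F'(x) exists and is non-zero. Then the Hausdorff dimension of F(A) equals the Hausdorff dimension of A. -/
open MeasureTheory

/-- A map that is Lipschitz and antilipschitz on a set preserves its Hausdorff dimension. -/
theorem dimH_image_eq_of_lipschitzOnWith_of_antilipschitzWith_domRestrict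
    {X Y : Type*} [EMetricSpace X] [EMetricSpace Y] {f : X → Y} {s : Set X} {K L : NNReal}
    (hf : LipschitzOnWith K f s) (hf' : AntilipschitzWith L (s.domRestrict f)) :
    dimH (f '' s) = dimH s := by
  refine le_antisymm hf.dimH_image_le ?_
  have h := hf'.le_dimH_image Set.univ
  rwa [Set.image_univ, Set.range_domRestrict, ← isometry_subtype_coe.dimH_image, Set.image_univ,
    Subtype.range_coe] at h

/-- The points of `A` at which `F` satisfies two-sided Lipschitz bounds with constant `n` at
scales below `1 / (n + 1)`, restricted to the `k`-th interval of a partition of `ℝ` into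
half-open intervals of length `1 / (n + 1)`. -/
def biLipschitzPiece (F : ℝ → ℝ) (A : Set ℝ) (n : ℕ) (k : ℤ) : Set ℝ :=
  {x ∈ A | ⌊((n : ℝ) + 1) * x⌋ = k ∧ ∀ y, |y - x| < 1 / ((n : ℝ) + 1) →
    |F y - F x| ≤ n * |y - x| ∧ |y - x| ≤ n * |F y - F x|}

theorem bounds_of_mem_biLipschitzPiece {F : ℝ → ℝ} {A : Set ℝ} {n : ℕ} {k : ℤ} {x y : ℝ}
    (hx : x ∈ biLipschitzPiece F A n k) (hy : y ∈ biLipschitzPiece F A n k) :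
    |F x - F y| ≤ n * |x - y| ∧ |x - y| ≤ n * |F x - F y| := by
  refine hy.2.2 x ?_
  have hn : (0 : ℝ) < n + 1 := by positivity
  have h := Int.abs_sub_lt_one_of_floor_eq_floor (hx.2.1.trans hy.2.1.symm)
  rw [← mul_sub, abs_mul, abs_of_pos hn] at h
  rwa [lt_div_iff₀' hn]

theorem dimH_image_biLipschitzPiece (F : ℝ → ℝ) (A : Set ℝ) (n : ℕ) (k : ℤ) :
    dimH (F '' biLipschitzPiece F A n k) = dimH (biLipschitzPiece F A n k) := by
  apply dimH_image_eq_of_lipschitzOnWith_of_antilipschitzWith_domRestrict (K := n) (L := n)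
  · refine LipschitzOnWith.of_dist_le_mul fun x hx y hy ↦ ?_
    simpa [Real.dist_eq] using (bounds_of_mem_biLipschitzPiece hx hy).1
  · refine AntilipschitzWith.of_le_mul_dist fun x y ↦ ?_
    simpa [Subtype.dist_eq, Real.dist_eq, Set.domRestrict_apply] using
      (bounds_of_mem_biLipschitzPiece x.2 y.2).2

theorem exists_mem_biLipschitzPiece {F : ℝ → ℝ} {A : Set ℝ} {x c : ℝ} (hx : x ∈ A)
    (hc : c ≠ 0) (hF : HasDerivAt F c x) : ∃ n k, x ∈ biLipschitzPiece F A n k := by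
  obtain ⟨C, hC⟩ := hF.isBigO_sub.bound
  obtain ⟨D, hD⟩ := (HasDerivAtFilter.isTheta_sub hF hc).isBigO_symm.bound
  rw [Filter.prod_pure, Filter.eventually_map] at hD
  obtain ⟨ε, hε, h⟩ := Metric.eventually_nhds_iff.1 (hC.and hD)
  obtain ⟨m, hm⟩ := exists_nat_one_div_lt hε
  obtain ⟨p, hp⟩ := exists_nat_ge (max C D)
  have hpn : (p : ℝ) ≤ (max m p : ℕ) := by exact_mod_cast le_max_right m p
  refine ⟨max m p, _, hx, rfl, fun y hy ↦ ?_⟩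
  have hmn : 1 / (((max m p : ℕ) : ℝ) + 1) ≤ 1 / ((m : ℝ) + 1) :=
    Nat.one_div_le_one_div (le_max_left m p)
  obtain ⟨h₁, h₂⟩ := h (show dist y x < ε from hy.trans (hmn.trans_lt hm))
  simp only [Real.norm_eq_abs] at h₁ h₂
  exact ⟨h₁.trans (by gcongr; exact (le_max_left C D).trans (hp.trans hpn)),
    h₂.trans (by gcongr; exact (le_max_right C D).trans (hp.trans hpn))⟩

theorem dimH_image_eq_of_hasDerivAt_ne_zero (F : ℝ → ℝ) (A : Set ℝ)
    (hdiff : ∀ x ∈ A, ∃ c : ℝ, c ≠ 0 ∧ HasDerivAt F c x) :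
    dimH (F '' A) = dimH A := by
  have hA : A = ⋃ (n : ℕ) (k : ℤ), biLipschitzPiece F A n k := by
    refine Set.Subset.antisymm (fun x hx ↦ ?_) (Set.iUnion₂_subset fun n k x hx ↦ hx.1)
    obtain ⟨c, hc, hF⟩ := hdiff x hx
    exact Set.mem_iUnion₂.2 (exists_mem_biLipschitzPiece hx hc hF)
  calc dimH (F '' A) = dimH (F '' ⋃ (n : ℕ) (k : ℤ), biLipschitzPiece F A n k) := by rw [← hA]
    _ = dimH (⋃ (n : ℕ) (k : ℤ), biLipschitzPiece F A n k) := by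
      simp only [Set.image_iUnion, dimH_iUnion, dimH_image_biLipschitzPiece]
    _ = dimH A := by rw [← hA]
end

section
/- Let F : ℂ → ℂ be a function and let A ⊆ ℂ be a set such that for every x ∈ A there exists a non-zero complex number c with F complex-differentiable at x with derivative c. Then the Hausdorff dimension of F(A) equals the Hausdorff dimension of A. -/
open MeasureTheory

open Set Filter Topology
open scoped NNReal

theorem AntilipschitzWith.dimH_le_dimH_image_of_domRestrict {X Y : Type*} [EMetricSpace X]
    [EMetricSpace Y] {K : ℝ≥0} {f : X → Y} {t : Set X}
    (hf : AntilipschitzWith K (t.domRestrict f)) : dimH t ≤ dimH (f '' t) := by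
  have h := hf.le_dimH_image univ
  rwa [image_univ, range_domRestrict, ← isometry_subtype_coe.dimH_image, image_univ,
    Subtype.range_coe] at h

theorem dimH_image_eq_of_lipschitzOnWith_of_antilipschitzWith {X Y : Type*} [EMetricSpace X]
    [EMetricSpace Y] {K L : ℝ≥0} {f : X → Y} {t : Set X} (hf : LipschitzOnWith K f t)
    (hf' : AntilipschitzWith L (t.domRestrict f)) : dimH (f '' t) = dimH t :=
  le_antisymm hf.dimH_image_le hf'.dimH_le_dimH_image_of_domRestrict

/-- A map that is bi-Lipschitz on a neighborhood within `s` of each point of `s` preserves the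
Hausdorff dimension of `s`. -/
theorem dimH_image_eq_of_locally_bilipschitzOn {X Y : Type*} [EMetricSpace X] [EMetricSpace Y]
    [SecondCountableTopology X] {f : X → Y} {s : Set X}
    (hf : ∀ x ∈ s, ∃ K : ℝ≥0, ∃ t ∈ 𝓝[s] x,
      LipschitzOnWith K f t ∧ AntilipschitzWith K (t.domRestrict f)) :
    dimH (f '' s) = dimH s := by
  choose! K t htn hK hK' using hf
  rcases TopologicalSpace.countable_cover_nhdsWithin htn with ⟨u, hus, huc, huU⟩
  replace huU := inter_eq_self_of_subset_left huU
  rw [inter_iUnion₂] at huU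
  rw [← huU, image_iUnion₂, dimH_bUnion huc, dimH_bUnion huc]
  refine biSup_congr fun x hx => ?_
  refine dimH_image_eq_of_lipschitzOnWith_of_antilipschitzWith
    ((hK x (hus hx)).mono inter_subset_right) (L := K x) fun y z => ?_
  exact hK' x (hus hx) ⟨y, y.2.2⟩ ⟨z, z.2.2⟩

/-- A map whose distortion of distances to each point `x` of `s` is bounded above and below near
`x`, with bounds and neighborhoods that may depend on `x`, preserves the Hausdorff dimension
of `s`. -/
theorem dimH_image_eq_of_eventually_dist_le {X Y : Type*} [MetricSpace X] [MetricSpace Y]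
    [SecondCountableTopology X] {f : X → Y} {s : Set X}
    (hf : ∀ x ∈ s, ∃ K : ℝ, ∀ᶠ z in 𝓝 x,
      dist (f z) (f x) ≤ K * dist z x ∧ dist z x ≤ K * dist (f z) (f x)) :
    dimH (f '' s) = dimH s := by
  let S : ℕ → Set X := fun n => {x ∈ s | ∀ z, dist z x < 1 / ((n : ℝ) + 1) →
    dist (f z) (f x) ≤ n * dist z x ∧ dist z x ≤ n * dist (f z) (f x)}
  have hS : s = ⋃ n, S n := by
    refine Subset.antisymm (fun x hx => ?_) (iUnion_subset fun n => sep_subset _ _)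
    obtain ⟨K, hK⟩ := hf x hx
    obtain ⟨ε, hε, hball⟩ := Metric.eventually_nhds_iff.1 hK
    obtain ⟨m, hm⟩ := exists_nat_one_div_lt hε
    obtain ⟨k, hk⟩ := exists_nat_ge K
    refine mem_iUnion.2 ⟨max m k, hx, fun z hz => ?_⟩
    have hKn : K ≤ (max m k : ℕ) := hk.trans (by exact_mod_cast le_max_right m k)
    have hzε : dist z x < ε := (hz.trans_le (Nat.one_div_le_one_div (le_max_left m k))).trans hm
    exact (hball hzε).imp (·.trans (by gcongr)) (·.trans (by gcongr))
  rw [hS, image_iUnion, dimH_iUnion, dimH_iUnion]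
  refine iSup_congr fun n => dimH_image_eq_of_locally_bilipschitzOn fun x _ => ?_
  have hr : (0 : ℝ) < 1 / ((n : ℝ) + 1) / 2 := by positivity
  have hclose : ∀ y ∈ S n ∩ Metric.ball x (1 / ((n : ℝ) + 1) / 2),
      ∀ z ∈ S n ∩ Metric.ball x (1 / ((n : ℝ) + 1) / 2),
      dist (f y) (f z) ≤ n * dist y z ∧ dist y z ≤ n * dist (f y) (f z) := by
    intro y hy z hz
    refine hz.1.2 y ?_
    linarith [dist_triangle_right y z x, Metric.mem_ball.1 hy.2, Metric.mem_ball.1 hz.2]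
  refine ⟨n, _, inter_mem_nhdsWithin _ (Metric.ball_mem_nhds x hr), ?_, ?_⟩
  · exact LipschitzOnWith.of_dist_le_mul fun y hy z hz => (hclose y hy z hz).1
  · exact AntilipschitzWith.of_le_mul_dist fun y z => (hclose y y.2 z z.2).2

theorem HasDerivAt.exists_eventually_dist_le {𝕜 F : Type*} [NontriviallyNormedField 𝕜]
    [NormedAddCommGroup F] [NormedSpace 𝕜 F] {f : 𝕜 → F} {c : F} {x : 𝕜}
    (hf : HasDerivAt f c x) (hc : c ≠ 0) :
    ∃ K : ℝ, ∀ᶠ z in 𝓝 x,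
      dist (f z) (f x) ≤ K * dist z x ∧ dist z x ≤ K * dist (f z) (f x) := by
  obtain ⟨K, hK⟩ := hf.isBigO_sub.bound
  obtain ⟨L, hL⟩ := (HasDerivAtFilter.isTheta_sub hf hc).isBigO_symm.bound
  rw [prod_pure, eventually_map] at hL
  refine ⟨max K L, ?_⟩
  filter_upwards [hK, hL] with z hz hz'
  simp only [dist_eq_norm]
  exact ⟨hz.trans (by gcongr; exact le_max_left _ _), hz'.trans (by gcongr; exact le_max_right _ _)⟩

theorem dimH_image_eq_of_complex_hasDerivAt_ne_zero (F : ℂ → ℂ) (A : Set ℂ)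
    (hdiff : ∀ x ∈ A, ∃ c : ℂ, c ≠ 0 ∧ HasDerivAt F c x) :
    dimH (F '' A) = dimH A :=
  dimH_image_eq_of_eventually_dist_le fun x hx =>
    let ⟨_, hc, hF⟩ := hdiff x hx
    hF.exists_eventually_dist_le hc
end

section
/- Let h : ℝ → ℝ be a homeomorphism and suppose there exists a set Λ ⊆ ℝ with Hausdorff dimension 1 such that for every x ∈ Λ the derivative h'(x) exists and is non-zero. Then for every set E ⊆ ℝ, max(dimH E, dimH h(ℝ \ E)) = 1. -/
open MeasureTheory

/-- A map which is differentiable within `s` at every point of `s` does not increase the Hausdorff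
dimension of `s`. -/
theorem DifferentiableOn.dimH_image_le {E F : Type*} [NormedAddCommGroup E] [NormedSpace ℝ E]
    [FiniteDimensional ℝ E] [NormedAddCommGroup F] [NormedSpace ℝ F] [SecondCountableTopology F]
    {f : E → F} {s : Set E} (hf : DifferentiableOn ℝ f s) : dimH (f '' s) ≤ dimH s := by
  obtain ⟨t, A, -, hst, hA, -⟩ := exists_closed_cover_approximatesLinearOn_of_hasFDerivWithinAt f s
    (fderivWithin ℝ f s) (fun x hx ↦ (hf x hx).hasFDerivWithinAt) (fun _ ↦ 1)
    (fun _ ↦ one_ne_zero)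
  have hcover : f '' s ⊆ ⋃ n, f '' (s ∩ t n) := by
    rw [← Set.image_iUnion, ← Set.inter_iUnion]
    exact Set.image_mono (Set.subset_inter subset_rfl hst)
  calc dimH (f '' s) ≤ ⨆ n, dimH (f '' (s ∩ t n)) := (dimH_mono hcover).trans_eq (dimH_iUnion _)
    _ ≤ dimH s := iSup_le fun n ↦
      (lipschitzOnWith_iff_restrict.2 (hA n).lipschitz).dimH_image_le.trans
        (dimH_mono Set.inter_subset_left)

/-- A homeomorphism of the line with a non-zero derivative at every point of `s` does not decrease
the Hausdorff dimension of `s`. -/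
theorem Homeomorph.le_dimH_image_of_hasDerivAt (h : Homeomorph ℝ ℝ) {s : Set ℝ}
    (hs : ∀ x ∈ s, ∃ c : ℝ, c ≠ 0 ∧ HasDerivAt h c x) : dimH s ≤ dimH (h '' s) := by
  have hdiff : DifferentiableOn ℝ h.symm (h '' s) := by
    rintro _ ⟨x, hx, rfl⟩
    obtain ⟨c, hc, hderiv⟩ := hs x hx
    refine (HasDerivAt.of_local_left_inverse h.symm.continuous.continuousAt
      (by simpa using hderiv) hc
      (.of_forall h.apply_symm_apply)).differentiableAt.differentiableWithinAt
  simpa [Set.image_image] using hdiff.dimH_image_le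

theorem max_dimH_eq_one (h : Homeomorph ℝ ℝ) (Λ : Set ℝ) (hΛ : dimH Λ = 1)
    (hdiff : ∀ x ∈ Λ, ∃ c : ℝ, c ≠ 0 ∧ HasDerivAt h c x) :
    ∀ E : Set ℝ, max (dimH E) (dimH (h '' (Set.univ \ E))) = 1 := by
  intro E
  have hle (s : Set ℝ) : dimH s ≤ 1 := (dimH_mono s.subset_univ).trans_eq Real.dimH_univ
  refine le_antisymm (max_le (hle _) (hle _)) ?_
  calc 1 = max (dimH (Λ ∩ E)) (dimH (Λ \ E)) := by
        rw [← dimH_union, Set.inter_union_sdiff, hΛ]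
    _ ≤ max (dimH E) (dimH (h '' (Λ \ E))) :=
      max_le_max (dimH_mono Set.inter_subset_right)
        (h.le_dimH_image_of_hasDerivAt fun x hx ↦ hdiff x hx.1)
    _ ≤ max (dimH E) (dimH (h '' (Set.univ \ E))) :=
      max_le_max le_rfl
        (dimH_mono (Set.image_mono (Set.sdiff_subset_sdiff_left Λ.subset_univ)))
end
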